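/- arXiv:1507.06099 — 2 statements merged into one kernel-verified Lean document; each statement's English description precedes it below -/
import Mathlib

section
/- Let p, q ∈ [2, ∞) be real numbers with 1/p + 1/q ≤ 1/2, and set λ = pq/(pq − p − q) (so that λ ≤ 2). Then there exists a constant C ≥ 1 such that for every positive integer n and every bilinear form A : ℓ_p^n × ℓ_q^n → 𝕂 (𝕂 = ℝ or ℂ), one has (∑_{k=1}^n (∑_{j=1}^n |A(e_j, e_k)|^λ)^{2/λ})^{1/2} ≤ C‖A‖. -/
open scoped BigOperators

/-- The `ℓ_p` norm of a vector in `𝕂^n`: `(∑ i, ‖x i‖^p)^(1/p)`. -/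
noncomputable def lpNorm (𝕂 : Type*) [RCLike 𝕂] (p : ℝ) {n : ℕ} (x : Fin n → 𝕂) : ℝ :=
  (∑ i, ‖x i‖ ^ p) ^ (1 / p)

/-- The sup norm of a bilinear form on `ℓ_p^n × ℓ_q^n`. -/
noncomputable def bilinNorm (𝕂 : Type*) [RCLike 𝕂] (p q : ℝ) {n : ℕ}
    (A : (Fin n → 𝕂) →ₗ[𝕂] (Fin n → 𝕂) →ₗ[𝕂] 𝕂) : ℝ :=
  sSup {t : ℝ | ∃ x y : Fin n → 𝕂, lpNorm 𝕂 p x ≤ 1 ∧ lpNorm 𝕂 q y ≤ 1 ∧ t = ‖A x y‖}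

/-- The sum of the vectors `v i`, `i ∈ s`, with sign `+` on `t` and `-` off `t`. -/
def signedSum {ι E : Type*} [DecidableEq ι] [AddCommGroup E] (s t : Finset ι) (v : ι → E) : E :=
  ∑ i ∈ s, if i ∈ t then v i else -v i

section Khinchine

variable {ι E : Type*} [DecidableEq ι]

lemma signedSum_insert_of_subset [AddCommGroup E] {a : ι} {s t : Finset ι} (ha : a ∉ s)
    (ht : t ⊆ s) (v : ι → E) : signedSum (insert a s) t v = signedSum s t v - v a := by
  have hat : a ∉ t := fun h => ha (ht h)
  simp [signedSum, Finset.sum_insert ha, hat, sub_eq_add_neg, add_comm]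

lemma signedSum_insert_insert [AddCommGroup E] {a : ι} {s : Finset ι} (ha : a ∉ s)
    (t : Finset ι) (v : ι → E) :
    signedSum (insert a s) (insert a t) v = signedSum s t v + v a := by
  rw [signedSum, Finset.sum_insert ha, signedSum, add_comm]
  congr 1
  · refine Finset.sum_congr rfl fun i hi => ?_
    have : i ≠ a := fun h => ha (h ▸ hi)
    simp [this]
  · simp

lemma norm_sub_pow_four_add_norm_add_pow_four_le (𝕜 : Type*) [RCLike 𝕜]
    [NormedAddCommGroup E] [InnerProductSpace 𝕜 E]
    (x y : E) :
    ‖x - y‖ ^ 4 + ‖x + y‖ ^ 4 ≤ 2 * ‖x‖ ^ 4 + 12 * ‖x‖ ^ 2 * ‖y‖ ^ 2 + 2 * ‖y‖ ^ 4 := by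
  have h₁ := parallelogram_law_with_norm 𝕜 x y
  have h₂ : ‖x + y‖ ^ 2 ≤ (‖x‖ + ‖y‖) ^ 2 := by gcongr; exact norm_add_le x y
  have h₃ : ‖x - y‖ ^ 2 ≤ (‖x‖ + ‖y‖) ^ 2 := by gcongr; exact norm_sub_le x y
  have h₄ : ‖x - y‖ ^ 2 = 2 * (‖x‖ ^ 2 + ‖y‖ ^ 2) - ‖x + y‖ ^ 2 := by linarith
  have h₅ : ‖x - y‖ ^ 4 = (2 * (‖x‖ ^ 2 + ‖y‖ ^ 2) - ‖x + y‖ ^ 2) ^ 2 := by rw [← h₄]; ring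
  rw [h₄] at h₃
  rw [h₅]
  nlinarith [mul_nonneg (sub_nonneg.2 h₂) (sub_nonneg.2 h₃)]

lemma sum_norm_signedSum_sq (𝕜 : Type*) [RCLike 𝕜]
    [NormedAddCommGroup E] [InnerProductSpace 𝕜 E]
    (s : Finset ι) (v : ι → E) :
    ∑ t ∈ s.powerset, ‖signedSum s t v‖ ^ 2 = 2 ^ s.card * ∑ i ∈ s, ‖v i‖ ^ 2 := by
  induction s using Finset.induction_on with
  | empty => simp [signedSum]
  | insert a s ha ih =>
    have h : ∀ t ∈ s.powerset, ‖signedSum (insert a s) t v‖ ^ 2 +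
        ‖signedSum (insert a s) (insert a t) v‖ ^ 2 =
        2 * ‖signedSum s t v‖ ^ 2 + 2 * ‖v a‖ ^ 2 := fun t ht => by
      rw [signedSum_insert_of_subset ha (Finset.mem_powerset.1 ht), signedSum_insert_insert ha]
      linarith [parallelogram_law_with_norm 𝕜 (signedSum s t v) (v a)]
    rw [Finset.sum_powerset_insert ha, ← Finset.sum_add_distrib, Finset.sum_congr rfl h,
      Finset.sum_add_distrib, ← Finset.mul_sum, ih, Finset.sum_const, Finset.card_powerset,
      Finset.card_insert_of_notMem ha, Finset.sum_insert ha, nsmul_eq_mul]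
    push_cast
    ring

lemma sum_norm_signedSum_pow_four_le (𝕜 : Type*) [RCLike 𝕜]
    [NormedAddCommGroup E] [InnerProductSpace 𝕜 E]
    (s : Finset ι) (v : ι → E) :
    ∑ t ∈ s.powerset, ‖signedSum s t v‖ ^ 4 ≤ 2 ^ s.card * (3 * (∑ i ∈ s, ‖v i‖ ^ 2) ^ 2) := by
  induction s using Finset.induction_on with
  | empty => simp [signedSum]
  | insert a s ha ih =>
    have h : ∀ t ∈ s.powerset, ‖signedSum (insert a s) t v‖ ^ 4 +
        ‖signedSum (insert a s) (insert a t) v‖ ^ 4 ≤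
        2 * ‖signedSum s t v‖ ^ 4 + 12 * ‖v a‖ ^ 2 * ‖signedSum s t v‖ ^ 2 + 2 * ‖v a‖ ^ 4 :=
      fun t ht => by
        rw [signedSum_insert_of_subset ha (Finset.mem_powerset.1 ht), signedSum_insert_insert ha]
        linarith [norm_sub_pow_four_add_norm_add_pow_four_le 𝕜 (signedSum s t v) (v a)]
    rw [Finset.sum_powerset_insert ha, ← Finset.sum_add_distrib]
    refine (Finset.sum_le_sum h).trans ?_
    rw [Finset.sum_add_distrib, Finset.sum_add_distrib, ← Finset.mul_sum, ← Finset.mul_sum,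
      sum_norm_signedSum_sq 𝕜, Finset.sum_const, Finset.card_powerset,
      Finset.card_insert_of_notMem ha, Finset.sum_insert ha, nsmul_eq_mul]
    push_cast
    have : (0 : ℝ) ≤ 2 ^ s.card * ‖v a‖ ^ 4 := by positivity
    rw [pow_succ (2 : ℝ)]
    linarith

/-- Khinchine's inequality with exponent one, with the non-optimal constant `2`. -/
lemma khinchine_one (𝕜 : Type*) [RCLike 𝕜]
    [NormedAddCommGroup E] [InnerProductSpace 𝕜 E]
    (s : Finset ι) (v : ι → E) :
    √(∑ i ∈ s, ‖v i‖ ^ 2) ≤ 2 * ∑ t ∈ s.powerset, (2 ^ s.card)⁻¹ * ‖signedSum s t v‖ := by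
  set σ := √(∑ i ∈ s, ‖v i‖ ^ 2) with hσ
  have hσ2 : ∑ i ∈ s, ‖v i‖ ^ 2 = σ ^ 2 := (Real.sq_sqrt (by positivity)).symm
  rcases (Real.sqrt_nonneg _ : 0 ≤ σ).eq_or_lt with h0 | h0
  · rw [hσ, ← h0]; positivity
  have h₂ := sum_norm_signedSum_sq 𝕜 s v
  have h₄ := sum_norm_signedSum_pow_four_le 𝕜 s v
  rw [hσ2] at h₂ h₄
  have h : ∀ t ∈ s.powerset, 12 * σ ^ 2 * ‖signedSum s t v‖ ^ 2 ≤
      16 * σ ^ 3 * ‖signedSum s t v‖ + ‖signedSum s t v‖ ^ 4 := fun t _ => by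
    set X := ‖signedSum s t v‖
    have hX : 0 ≤ X := norm_nonneg _
    have : 0 ≤ X * ((X - 2 * σ) ^ 2 * (X + 4 * σ)) := by positivity
    linarith
  have := Finset.sum_le_sum h
  rw [Finset.sum_add_distrib, ← Finset.mul_sum, ← Finset.mul_sum, h₂] at this
  rw [← Finset.mul_sum]
  have hN : (0 : ℝ) < 2 ^ s.card := by positivity
  set N : ℝ := 2 ^ s.card
  set T := ∑ t ∈ s.powerset, ‖signedSum s t v‖
  have h9 : σ ^ 3 * (9 * (N * σ)) ≤ σ ^ 3 * (16 * T) := by linarith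
  have h10 : 9 * (N * σ) ≤ 16 * T := le_of_mul_le_mul_left h9 (by positivity)
  have h11 : 0 ≤ T := by positivity
  rw [← div_eq_inv_mul, mul_div_assoc', le_div_iff₀ hN]
  linarith

end Khinchine

section NNRealSums

open scoped NNReal

variable {ι κ : Type*}

/-- A converse of Hölder's inequality. -/
lemma sum_rpow_le_of_forall_sum_mul_le (s : Finset ι) (f : ι → ℝ≥0) {p q : ℝ}
    (hpq : p.HolderConjugate q) (D : ℝ≥0)
    (h : ∀ g : ι → ℝ≥0, ∑ i ∈ s, g i ^ q ≤ 1 → ∑ i ∈ s, f i * g i ≤ D) :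
    ∑ i ∈ s, f i ^ p ≤ D ^ p := by
  obtain ⟨⟨g, hg, hfg⟩, -⟩ := NNReal.isGreatest_Lp s f hpq
  have := h g hg
  simp only at hfg
  rw [hfg, one_div, NNReal.rpow_inv_le_iff hpq.pos] at this
  exact this

lemma sum_rpow_le_of_forall_sum_rpow_le (s : Finset ι) (f : ι → ℝ≥0) {l p r : ℝ}
    (h : l.HolderTriple p r) (D : ℝ≥0)
    (H : ∀ g : ι → ℝ≥0, ∑ i ∈ s, g i ^ p ≤ 1 → ∑ i ∈ s, (f i * g i) ^ r ≤ D ^ r) :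
    ∑ i ∈ s, f i ^ l ≤ D ^ l := by
  have hr := h.pos'
  have := sum_rpow_le_of_forall_sum_mul_le s (fun i => f i ^ r) h.holderConjugate_div_div (D ^ r)
    fun g hg => by
      have := H (fun i => g i ^ r⁻¹) (by
        simpa only [← NNReal.rpow_mul, inv_mul_eq_div] using hg)
      simpa only [NNReal.mul_rpow, NNReal.rpow_inv_rpow hr.ne'] using this
  simpa only [← NNReal.rpow_mul, mul_div_cancel₀ _ hr.ne'] using this

/-- Minkowski's inequality for finite families. -/
lemma Lp_sum_le (s : Finset ι) (t : Finset κ) (f : ι → κ → ℝ≥0) {p : ℝ} (hp : 1 ≤ p) :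
    (∑ k ∈ t, (∑ j ∈ s, f j k) ^ p) ^ (1 / p) ≤ ∑ j ∈ s, (∑ k ∈ t, f j k ^ p) ^ (1 / p) := by
  have hp0 : p ≠ 0 := by positivity
  classical
  induction s using Finset.induction_on with
  | empty => simp [hp0]
  | insert a s ha ih =>
    simp only [Finset.sum_insert ha]
    exact (NNReal.Lp_add_le t _ _ hp).trans (by gcongr)

/-- Mixed norms decrease when the larger exponent is moved outside. -/
lemma mixed_norm_swap_le (s : Finset ι) (t : Finset κ) (b : ι → κ → ℝ≥0) {l : ℝ} (hl : 0 < l)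
    (hl2 : l ≤ 2) :
    (∑ k ∈ t, (∑ j ∈ s, b j k ^ l) ^ (2 / l)) ^ (1 / 2 : ℝ) ≤
      (∑ j ∈ s, (∑ k ∈ t, b j k ^ 2) ^ (l / 2)) ^ (1 / l) := by
  have h := Lp_sum_le s t (fun j k => b j k ^ l) ((one_le_div hl).2 hl2)
  simp only [← NNReal.rpow_mul, mul_div_cancel₀ _ hl.ne', one_div_div, NNReal.rpow_two] at h
  have h2 := NNReal.rpow_le_rpow h (one_div_pos.2 hl).le
  rw [← NNReal.rpow_mul] at h2
  convert h2 using 2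
  field_simp

/-- Interpolation between an `ℓ_μ(ℓ_2)` bound by columns and a weighted `ℓ_1(ℓ_2)` bound by rows
gives an `ℓ_μ(ℓ_2)` bound by rows. -/
lemma row_sum_le_of_column_sum_le (s : Finset ι) (t : Finset κ) (b : ι → κ → ℝ≥0) {μ q : ℝ}
    (hμq : μ.HolderConjugate q) (hq : 2 ≤ q) (D : ℝ≥0)
    (hcol : ∑ k ∈ t, (∑ j ∈ s, b j k ^ 2) ^ (μ / 2) ≤ D ^ μ)
    (hrow : ∀ y : κ → ℝ≥0, ∑ k ∈ t, y k ^ q ≤ 1 →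
      ∑ j ∈ s, NNReal.sqrt (∑ k ∈ t, (b j k * y k) ^ 2) ≤ D) :
    ∑ j ∈ s, (∑ k ∈ t, b j k ^ 2) ^ (μ / 2) ≤ D ^ μ := by
  have hμ1 := hμq.lt
  have hμ0 := hμq.pos
  rcases hq.eq_or_lt with rfl | hq
  · have : μ = 2 := by have := hμq.mul_eq_add; linarith
    subst this
    simp only [ne_eq, OfNat.ofNat_ne_zero, not_false_eq_true, div_self, NNReal.rpow_one] at *
    rwa [Finset.sum_comm]
  have hmul := hμq.mul_eq_add
  have hμ2 : μ < 2 := by nlinarith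
  set S : ι → ℝ≥0 := fun j => NNReal.sqrt (∑ k ∈ t, b j k ^ 2) with hS
  have hS2 : ∀ j, ∑ k ∈ t, b j k ^ 2 = S j ^ 2 := fun j => by simp [hS]
  set P : κ → ℝ≥0 := fun k => ∑ j ∈ s, b j k ^ 2 / S j with hP
  set Q : κ → ℝ≥0 := fun k => ∑ j ∈ s, b j k ^ 2 with hQ
  have hPsum : ∑ k ∈ t, P k ^ μ ≤ D ^ μ := by
    refine sum_rpow_le_of_forall_sum_mul_le t P hμq D fun y hy => ?_
    refine le_trans ?_ (hrow y hy)
    simp only [hP, Finset.sum_mul]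
    rw [Finset.sum_comm]
    refine Finset.sum_le_sum fun j _ => ?_
    have hcs : ∑ k ∈ t, b j k * (b j k * y k) ≤
        S j * NNReal.sqrt (∑ k ∈ t, (b j k * y k) ^ 2) := by
      have := NNReal.inner_le_Lp_mul_Lq t (b j) (fun k => b j k * y k) Real.HolderConjugate.two_two
      simpa only [NNReal.rpow_two, ← NNReal.sqrt_eq_rpow] using this
    calc ∑ k ∈ t, b j k ^ 2 / S j * y k = (∑ k ∈ t, b j k * (b j k * y k)) / S j := by
          rw [Finset.sum_div]
          exact Finset.sum_congr rfl fun k _ => by ring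
      _ ≤ (S j * NNReal.sqrt (∑ k ∈ t, (b j k * y k) ^ 2)) / S j := by gcongr
      _ ≤ _ := by
          rcases eq_or_ne (S j) 0 with h | h
          · simp [h]
          · rw [mul_div_cancel_left₀ _ h]
  have hsplit : ∀ j ∈ s, (∑ k ∈ t, b j k ^ 2) ^ (μ / 2) =
      ∑ k ∈ t, (b j k ^ 2 / S j) ^ (2 - μ) * (b j k ^ 2) ^ (μ - 1) := fun j _ => by
    rcases eq_or_ne (S j) 0 with h | h
    · have hz : ∀ k ∈ t, b j k ^ 2 = 0 := by
        have := hS2 j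
        rw [h] at this
        simpa using this
      have h1 : μ - 1 ≠ 0 := by linarith
      rw [hS2, h, Finset.sum_eq_zero fun k hk => by simp [hz k hk, h1]]
      simp [hμ0.ne']
    · have : ∀ k ∈ t, (b j k ^ 2 / S j) ^ (2 - μ) * (b j k ^ 2) ^ (μ - 1) =
          b j k ^ 2 * S j ^ (μ - 2) := fun k _ => by
        rcases eq_or_ne (b j k) 0 with hb | hb
        · have h1 : μ - 1 ≠ 0 := by linarith
          simp [hb, h1]
        · have hb2 : b j k ^ 2 ≠ 0 := pow_ne_zero _ hb
          rw [div_eq_mul_inv, NNReal.mul_rpow, NNReal.inv_rpow, ← NNReal.rpow_neg, mul_right_comm,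
            ← NNReal.rpow_add hb2, neg_sub]
          norm_num
      rw [Finset.sum_congr rfl this, ← Finset.sum_mul, hS2, ← NNReal.rpow_two,
        ← NNReal.rpow_mul, ← NNReal.rpow_add h]
      congr 1; ring
  have h1 : (2 - μ)⁻¹.HolderConjugate (μ - 1)⁻¹ :=
    Real.HolderConjugate.inv_inv (by linarith) (by linarith) (by ring)
  have h2 : (μ / (2 - μ)).HolderConjugate (q / 2) := by
    refine Real.holderConjugate_iff.2 ⟨(one_lt_div (by linarith)).2 (by linarith), ?_⟩
    have : q ≠ 0 := by linarith
    field_simp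
    linarith
  calc ∑ j ∈ s, (∑ k ∈ t, b j k ^ 2) ^ (μ / 2)
      = ∑ k ∈ t, ∑ j ∈ s, (b j k ^ 2 / S j) ^ (2 - μ) * (b j k ^ 2) ^ (μ - 1) := by
        rw [Finset.sum_congr rfl hsplit, Finset.sum_comm]
    _ ≤ ∑ k ∈ t, P k ^ (2 - μ) * Q k ^ (μ - 1) := by
        refine Finset.sum_le_sum fun k _ => ?_
        have h3 : 2 - μ ≠ 0 := by linarith
        have h4 : μ - 1 ≠ 0 := by linarith
        refine (NNReal.inner_le_Lp_mul_Lq s _ _ h1).trans_eq ?_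
        simp only [NNReal.rpow_rpow_inv h3, NNReal.rpow_rpow_inv h4, one_div, inv_inv, hP, hQ]
    _ ≤ (∑ k ∈ t, P k ^ μ) ^ (1 / (μ / (2 - μ))) * (∑ k ∈ t, Q k ^ (μ / 2)) ^ (1 / (q / 2)) := by
        refine (NNReal.inner_le_Lp_mul_Lq t _ _ h2).trans_eq ?_
        have h3 : (2 - μ) * (μ / (2 - μ)) = μ := mul_div_cancel₀ _ (by linarith)
        have h4 : (μ - 1) * (q / 2) = μ / 2 := by linarith
        simp only [← NNReal.rpow_mul, h3, h4]
    _ ≤ (D ^ μ) ^ (1 / (μ / (2 - μ))) * (D ^ μ) ^ (1 / (q / 2)) := by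
        have := h2.one_div_nonneg
        have := h2.symm.one_div_nonneg
        gcongr
    _ = D ^ μ := by
        rw [← NNReal.rpow_add_of_nonneg _ h2.one_div_nonneg h2.symm.one_div_nonneg,
          h2.one_div_add_one_div, div_one, NNReal.rpow_one]

end NNRealSums

section BilinearForms

open scoped NNReal

variable {ι κ 𝕂 : Type*} [RCLike 𝕂]

lemma nnreal_khinchine_one [DecidableEq ι] (s : Finset ι) (v : ι → 𝕂) :
    NNReal.sqrt (∑ i ∈ s, ‖v i‖₊ ^ 2) ≤
      2 * ∑ t ∈ s.powerset, (2 ^ s.card)⁻¹ * ‖signedSum s t v‖₊ := by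
  rw [← NNReal.coe_le_coe]
  push_cast
  exact khinchine_one 𝕂 s v

lemma sum_powerset_inv_two_pow_card (s : Finset ι) :
    ∑ _t ∈ s.powerset, ((2 : ℝ≥0) ^ s.card)⁻¹ = 1 := by
  simp [Finset.card_powerset]

/-- The bilinear form with matrix `a` is bounded by `M` on the product of the unit balls of `ℓ_p`
and `ℓ_q`. -/
def BilinBoundedBy [Fintype ι] [Fintype κ] (p q : ℝ) (a : ι → κ → 𝕂) (M : ℝ≥0) : Prop :=
  ∀ (x : ι → 𝕂) (y : κ → 𝕂), ∑ j, ‖x j‖₊ ^ p ≤ 1 → ∑ k, ‖y k‖₊ ^ q ≤ 1 →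
    ‖∑ j, ∑ k, x j * y k * a j k‖₊ ≤ M

variable [Fintype ι] [Fintype κ] {p q : ℝ} {a : ι → κ → 𝕂} {M : ℝ≥0}

lemma BilinBoundedBy.symm (h : BilinBoundedBy p q a M) :
    BilinBoundedBy q p (fun k j => a j k) M := fun y x hy hx => by
  convert h x y hx hy using 2
  rw [Finset.sum_comm]
  simp only [mul_comm (x _)]

lemma BilinBoundedBy.sum_nnnorm_mul_le (h : BilinBoundedBy p q a M) {x : ι → 𝕂}
    (hx : ∑ j, ‖x j‖₊ ^ p ≤ 1) {y : κ → ℝ≥0} (hy : ∑ k, y k ^ q ≤ 1) :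
    ∑ k, ‖∑ j, x j * a j k‖₊ * y k ≤ M := by
  choose c hc hcz using fun k => RCLike.exists_norm_eq_mul_self (∑ j, x j * a j k)
  have hy' : ∀ k, ‖c k * ((y k : ℝ) : 𝕂)‖₊ = y k := fun k => by
    rw [← NNReal.coe_inj]; simp [hc k]
  have := h x (fun k => c k * ((y k : ℝ) : 𝕂)) hx (by simpa only [hy'] using hy)
  have hsum : ∑ j, ∑ k, x j * (c k * ((y k : ℝ) : 𝕂)) * a j k =
      ((∑ k, ‖∑ j, x j * a j k‖ * y k : ℝ) : 𝕂) := by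
    rw [Finset.sum_comm]
    rw [RCLike.ofReal_sum]
    refine Finset.sum_congr rfl fun k _ => ?_
    rw [RCLike.ofReal_mul, hcz, Finset.mul_sum, Finset.sum_mul]
    exact Finset.sum_congr rfl fun j _ => by ring
  rw [hsum, ← NNReal.coe_le_coe, coe_nnnorm, RCLike.norm_ofReal,
    abs_of_nonneg (by positivity)] at this
  rw [← NNReal.coe_le_coe]
  push_cast
  exact this

lemma BilinBoundedBy.sum_nnnorm_signedSum_mul_le [DecidableEq ι] (h : BilinBoundedBy p q a M)
    {x : ι → ℝ≥0} (hx : ∑ j, x j ^ p ≤ 1) {y : κ → ℝ≥0} (hy : ∑ k, y k ^ q ≤ 1) (t : Finset ι) :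
    ∑ k, ‖signedSum Finset.univ t fun j => ((x j : ℝ) : 𝕂) * a j k‖₊ * y k ≤ M := by
  have := h.sum_nnnorm_mul_le
    (x := fun j => if j ∈ t then ((x j : ℝ) : 𝕂) else -((x j : ℝ) : 𝕂)) (by
      refine le_trans (Finset.sum_le_sum fun j _ => le_of_eq ?_) hx
      congr 1
      rw [← NNReal.coe_inj]
      split_ifs <;> simp) hy
  convert this using 4 with k _ j
  simp only [signedSum, ite_mul, neg_mul]

lemma BilinBoundedBy.column_sum_le (h : BilinBoundedBy p q a M) {μ : ℝ}
    (hμq : μ.HolderConjugate q) {x : ι → ℝ≥0} (hx : ∑ j, x j ^ p ≤ 1) :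
    ∑ k, (∑ j, (‖a j k‖₊ * x j) ^ 2) ^ (μ / 2) ≤ (2 * M) ^ μ := by
  classical
  let X (t : Finset ι) (k : κ) : ℝ≥0 :=
    ‖signedSum Finset.univ t fun j => ((x j : ℝ) : 𝕂) * a j k‖₊
  let w : ℝ≥0 := (2 ^ (Finset.univ : Finset ι).card)⁻¹
  have hX : ∀ t, ∑ k, X t k ^ μ ≤ M ^ μ := fun t =>
    sum_rpow_le_of_forall_sum_mul_le _ _ hμq M fun y hy => h.sum_nnnorm_signedSum_mul_le hx hy t
  have hk : ∀ k, (∑ j, (‖a j k‖₊ * x j) ^ 2) ^ (μ / 2) ≤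
      2 ^ μ * ∑ t ∈ (Finset.univ : Finset ι).powerset, w * X t k ^ μ := fun k => by
    have h1 := nnreal_khinchine_one Finset.univ fun j => ((x j : ℝ) : 𝕂) * a j k
    have h2 : ∀ j, ‖((x j : ℝ) : 𝕂) * a j k‖₊ = ‖a j k‖₊ * x j := fun j => by
      rw [← NNReal.coe_inj]; simp [mul_comm]
    simp only [h2] at h1
    have h3 := NNReal.rpow_le_rpow h1 hμq.nonneg
    rw [NNReal.sqrt_eq_rpow, ← NNReal.rpow_mul, one_div_mul_eq_div, NNReal.mul_rpow] at h3
    refine h3.trans ?_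
    gcongr
    exact NNReal.rpow_arith_mean_le_arith_mean_rpow _ _ _ (sum_powerset_inv_two_pow_card _)
      hμq.lt.le
  calc _ ≤ ∑ k, 2 ^ μ * ∑ t ∈ (Finset.univ : Finset ι).powerset, w * X t k ^ μ :=
        Finset.sum_le_sum fun k _ => hk k
    _ = 2 ^ μ * ∑ t ∈ (Finset.univ : Finset ι).powerset, w * ∑ k, X t k ^ μ := by
        rw [← Finset.mul_sum, Finset.sum_comm]
        simp only [Finset.mul_sum]
    _ ≤ 2 ^ μ * ∑ t ∈ (Finset.univ : Finset ι).powerset, w * M ^ μ := by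
        gcongr with t _; exact hX t
    _ = (2 * M) ^ μ := by
        rw [← Finset.sum_mul, sum_powerset_inv_two_pow_card, one_mul, NNReal.mul_rpow]

lemma BilinBoundedBy.row_sum_sqrt_le (h : BilinBoundedBy p q a M) {x : ι → ℝ≥0}
    (hx : ∑ j, x j ^ p ≤ 1) {y : κ → ℝ≥0} (hy : ∑ k, y k ^ q ≤ 1) :
    ∑ j, NNReal.sqrt (∑ k, (‖a j k‖₊ * x j * y k) ^ 2) ≤ 2 * M := by
  classical
  let Y (t : Finset κ) (j : ι) : ℝ≥0 :=
    ‖signedSum Finset.univ t fun k => ((y k : ℝ) : 𝕂) * a j k‖₊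
  let w : ℝ≥0 := (2 ^ (Finset.univ : Finset κ).card)⁻¹
  have hj : ∀ j, NNReal.sqrt (∑ k, (‖a j k‖₊ * x j * y k) ^ 2) ≤
      2 * ∑ t ∈ (Finset.univ : Finset κ).powerset, w * (Y t j * x j) := fun j => by
    have h1 := nnreal_khinchine_one Finset.univ fun k => ((y k : ℝ) : 𝕂) * a j k
    have h2 : ∀ k, ‖a j k‖₊ * x j * y k = x j * ‖((y k : ℝ) : 𝕂) * a j k‖₊ := fun k => by
      rw [← NNReal.coe_inj]; simp; ring
    simp only [h2, mul_pow, ← Finset.mul_sum, NNReal.sqrt_mul, NNReal.sqrt_sq, ← mul_assoc,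
      ← Finset.sum_mul]
    rw [mul_comm, mul_assoc 2 w, Finset.mul_sum]
    exact mul_le_mul_left h1 _
  calc _ ≤ ∑ j, 2 * ∑ t ∈ (Finset.univ : Finset κ).powerset, w * (Y t j * x j) :=
        Finset.sum_le_sum fun j _ => hj j
    _ = 2 * ∑ t ∈ (Finset.univ : Finset κ).powerset, w * ∑ j, Y t j * x j := by
        rw [← Finset.mul_sum, Finset.sum_comm]
        simp only [Finset.mul_sum]
    _ ≤ 2 * ∑ t ∈ (Finset.univ : Finset κ).powerset, w * M := by
        gcongr with t _; exact h.symm.sum_nnnorm_signedSum_mul_le hy hx t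
    _ = 2 * M := by
        rw [← Finset.sum_mul, sum_powerset_inv_two_pow_card, one_mul]

/-- The Hardy–Littlewood inequality for bilinear forms, with the inner sum over the second
variable. -/
lemma BilinBoundedBy.hardy_littlewood (h : BilinBoundedBy p q a M) (hq : 2 ≤ q) {l μ : ℝ}
    (hμq : μ.HolderConjugate q) (hl : l.HolderTriple p μ) :
    ∑ j, (∑ k, ‖a j k‖₊ ^ 2) ^ (l / 2) ≤ (2 * M) ^ l := by
  have := sum_rpow_le_of_forall_sum_rpow_le Finset.univ
    (fun j => NNReal.sqrt (∑ k, ‖a j k‖₊ ^ 2)) hl (2 * M) fun x hx => by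
      have h1 := row_sum_le_of_column_sum_le Finset.univ Finset.univ
        (fun j k => ‖a j k‖₊ * x j) hμq hq (2 * M) (h.column_sum_le hμq hx)
        fun y hy => h.row_sum_sqrt_le hx hy
      convert h1 using 2 with j _
      rw [← mul_one_div μ 2, mul_comm μ, NNReal.rpow_mul, ← NNReal.sqrt_eq_rpow]
      simp only [mul_pow, ← Finset.sum_mul, NNReal.sqrt_mul, NNReal.sqrt_sq]
  simpa only [NNReal.sqrt_eq_rpow, ← NNReal.rpow_mul, one_div_mul_eq_div] using this

end BilinearForms

lemma norm_le_one_of_lpNorm_le_one {𝕂 : Type*} [RCLike 𝕂] {p : ℝ} (hp : 0 < p) {n : ℕ}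
    {x : Fin n → 𝕂} (hx : lpNorm 𝕂 p x ≤ 1) (i : Fin n) : ‖x i‖ ≤ 1 := by
  have h0 : 0 ≤ ∑ i, ‖x i‖ ^ p := by positivity
  have h1 : ∑ i, ‖x i‖ ^ p ≤ 1 := by
    rw [lpNorm, one_div] at hx
    simpa using (Real.rpow_inv_le_iff_of_pos h0 zero_le_one hp).1 hx
  have h2 : ‖x i‖ ^ p ≤ ∑ i, ‖x i‖ ^ p :=
    Finset.single_le_sum (f := fun i => ‖x i‖ ^ p) (fun i _ => by positivity) (Finset.mem_univ i)
  exact (Real.rpow_le_rpow_iff (norm_nonneg _) zero_le_one hp).1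
    (by simpa using h2.trans h1)

lemma bilin_apply_eq_sum {𝕂 : Type*} [RCLike 𝕂] {n : ℕ}
    (A : (Fin n → 𝕂) →ₗ[𝕂] (Fin n → 𝕂) →ₗ[𝕂] 𝕂) (x y : Fin n → 𝕂) :
    A x y = ∑ j, ∑ k, x j * y k * A (Pi.single j 1) (Pi.single k 1) := by
  conv_lhs => rw [pi_eq_sum_univ' x, pi_eq_sum_univ' y]
  simp only [map_sum, map_smul, LinearMap.sum_apply, LinearMap.smul_apply, smul_eq_mul]
  rw [Finset.sum_comm]
  simp only [Finset.mul_sum, mul_assoc, mul_left_comm]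

lemma le_bilinNorm {𝕂 : Type*} [RCLike 𝕂] {p q : ℝ} (hp : 0 < p) (hq : 0 < q) {n : ℕ}
    (A : (Fin n → 𝕂) →ₗ[𝕂] (Fin n → 𝕂) →ₗ[𝕂] 𝕂) {x y : Fin n → 𝕂} (hx : lpNorm 𝕂 p x ≤ 1)
    (hy : lpNorm 𝕂 q y ≤ 1) : ‖A x y‖ ≤ bilinNorm 𝕂 p q A := by
  refine le_csSup ⟨∑ j, ∑ k, ‖A (Pi.single j 1) (Pi.single k 1)‖, ?_⟩ ⟨x, y, hx, hy, rfl⟩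
  rintro _ ⟨x, y, hx, hy, rfl⟩
  rw [bilin_apply_eq_sum]
  refine norm_sum_le_of_le _ fun j _ => norm_sum_le_of_le _ fun k _ => ?_
  rw [norm_mul, norm_mul]
  exact mul_le_of_le_one_left (norm_nonneg _) (mul_le_one₀ (norm_le_one_of_lpNorm_le_one hp hx j)
    (norm_nonneg _) (norm_le_one_of_lpNorm_le_one hq hy k))

lemma bilinNorm_nonneg {𝕂 : Type*} [RCLike 𝕂] (p q : ℝ) {n : ℕ}
    (A : (Fin n → 𝕂) →ₗ[𝕂] (Fin n → 𝕂) →ₗ[𝕂] 𝕂) : 0 ≤ bilinNorm 𝕂 p q A := by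
  refine Real.sSup_nonneg ?_
  rintro _ ⟨x, y, -, -, rfl⟩
  exact norm_nonneg _

lemma bilinBoundedBy_bilinNorm {𝕂 : Type*} [RCLike 𝕂] {p q : ℝ} (hp : 0 < p) (hq : 0 < q) {n : ℕ}
    (A : (Fin n → 𝕂) →ₗ[𝕂] (Fin n → 𝕂) →ₗ[𝕂] 𝕂) :
    BilinBoundedBy p q (fun j k => A (Pi.single j 1) (Pi.single k 1))
      (.mk (bilinNorm 𝕂 p q A) (bilinNorm_nonneg p q A)) := fun x y hx hy => by
  rw [← NNReal.coe_le_coe, coe_nnnorm, ← bilin_apply_eq_sum, NNReal.coe_mk]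
  refine le_bilinNorm hp hq A ?_ ?_
  · exact Real.rpow_le_one (by positivity)
      (by simpa using NNReal.coe_le_coe.2 hx) (by positivity)
  · exact Real.rpow_le_one (by positivity)
      (by simpa using NNReal.coe_le_coe.2 hy) (by positivity)

theorem hardy_littlewood_interchanged
    (𝕂 : Type*) [RCLike 𝕂] (p q : ℝ) (hp : 2 ≤ p) (hq : 2 ≤ q)
    (hpq : 1 / p + 1 / q ≤ 1 / 2) (lam : ℝ) (hlam : lam = p * q / (p * q - p - q)) :
    ∃ C : ℝ, 1 ≤ C ∧ ∀ n : ℕ, 0 < n →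
      ∀ A : (Fin n → 𝕂) →ₗ[𝕂] (Fin n → 𝕂) →ₗ[𝕂] 𝕂,
        (∑ k : Fin n, (∑ j : Fin n,
            ‖A (Pi.single j (1 : 𝕂)) (Pi.single k (1 : 𝕂))‖ ^ lam) ^ (2 / lam)) ^ ((1 : ℝ) / 2)
          ≤ C * bilinNorm 𝕂 p q A := by
  have hp0 : 0 < p := by linarith
  have hq0 : 0 < q := by linarith
  have hinv : lam⁻¹ = 1 - 1 / p - 1 / q := by
    rw [hlam, inv_div]
    field_simp
    ring
  have hl0 : 0 < lam := inv_pos.1 (by linarith)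
  have hl2 : lam ≤ 2 := by
    rw [← inv_le_inv₀ two_pos hl0]
    linarith
  have hμq : (q.conjExponent).HolderConjugate q :=
    (Real.HolderConjugate.conjExponent (by linarith)).symm
  have hl : lam.HolderTriple p q.conjExponent := by
    refine ⟨?_, hl0, hp0⟩
    have := hμq.inv_add_inv_eq_one
    rw [hinv, one_div, one_div]
    linarith
  refine ⟨2, one_le_two, fun n _ A => ?_⟩
  have h1 := (bilinBoundedBy_bilinNorm hp0 hq0 A).hardy_littlewood hq hμq hl
  have h2 := (mixed_norm_swap_le Finset.univ Finset.univ
    (fun j k => ‖A (Pi.single j 1) (Pi.single k 1)‖₊) hl0 hl2).trans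
    (NNReal.rpow_le_rpow h1 (one_div_pos.2 hl0).le)
  rw [one_div lam, NNReal.rpow_rpow_inv hl0.ne', ← NNReal.coe_le_coe] at h2
  push_cast at h2
  exact h2
end

section
/- Let p, q ∈ [2, ∞) be real numbers with 1/2 < 1/p + 1/q < 1. If r > 0 and C > 0 are such that for every positive integer n and every bilinear form A : ℓ_p^n × ℓ_q^n → 𝕂 (𝕂 = ℝ or ℂ) one has (∑_{j,k=1}^n |A(e_j, e_k)|^r)^{1/r} ≤ C‖A‖, then r ≥ pq/(pq − p − q). -/
open scoped BigOperators

/-- Hölder's inequality with the constant sequence as third factor. -/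
theorem sum_mul_le_card_rpow {ι : Type*} [Fintype ι] [Nonempty ι] {p q : ℝ} (hp : 0 < p)
    (hq : 0 < q) (hpq : 1 / p + 1 / q ≤ 1) {a b : ι → ℝ} (ha : ∀ i, 0 ≤ a i)
    (hb : ∀ i, 0 ≤ b i) (hap : ∑ i, a i ^ p ≤ 1) (hbq : ∑ i, b i ^ q ≤ 1) :
    ∑ i, a i * b i ≤ (Fintype.card ι : ℝ) ^ (1 - 1 / p - 1 / q) := by
  set N : ℝ := (Fintype.card ι : ℝ)
  set s : ℝ := 1 - 1 / p - 1 / q with hs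
  have hN : 0 < N := by simp only [N]; exact_mod_cast Fintype.card_pos
  have hterm (i : ι) : a i * b i * N⁻¹ ^ s ≤ 1 / p * a i ^ p + 1 / q * b i ^ q + s * N⁻¹ := by
    have hgm := Real.geom_mean_le_arith_mean3_weighted (w₁ := 1 / p) (w₂ := 1 / q) (w₃ := s)
      (by positivity) (by positivity) (by linarith) (Real.rpow_nonneg (ha i) p)
      (Real.rpow_nonneg (hb i) q) (inv_nonneg.2 hN.le) (by linarith)
    rwa [← Real.rpow_mul (ha i), ← Real.rpow_mul (hb i), mul_one_div_cancel hp.ne',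
      mul_one_div_cancel hq.ne', Real.rpow_one, Real.rpow_one] at hgm
  have hsum : (∑ i, a i * b i) * N⁻¹ ^ s ≤ 1 := by
    calc (∑ i, a i * b i) * N⁻¹ ^ s
        ≤ ∑ i, (1 / p * a i ^ p + 1 / q * b i ^ q + s * N⁻¹) := by
          rw [Finset.sum_mul]; exact Finset.sum_le_sum fun i _ => hterm i
      _ = 1 / p * ∑ i, a i ^ p + 1 / q * ∑ i, b i ^ q + s := by
          simp only [Finset.sum_add_distrib, ← Finset.mul_sum, Finset.sum_const,
            Finset.card_univ, nsmul_eq_mul]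
          change _ + s * (N * N⁻¹) = _
          rw [mul_inv_cancel₀ hN.ne', mul_one]
      _ ≤ 1 / p * 1 + 1 / q * 1 + s := by gcongr
      _ = 1 := by rw [hs]; ring
  rwa [Real.inv_rpow hN.le, ← div_eq_mul_inv, div_le_one (by positivity)] at hsum

theorem sum_rpow_le_one_of_lpNorm_le_one {𝕂 : Type*} [RCLike 𝕂] {p : ℝ} (hp : 0 < p) {n : ℕ}
    {x : Fin n → 𝕂} (hx : lpNorm 𝕂 p x ≤ 1) : ∑ i, ‖x i‖ ^ p ≤ 1 := by
  contrapose! hx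
  exact Real.one_lt_rpow hx (by positivity)

/-- The norm of the diagonal form `∑ i, x i * y i` is at most `n ^ (1 - 1 / p - 1 / q)`. -/
theorem bilinNorm_dotProductBilin_le (𝕂 : Type*) [RCLike 𝕂] {p q : ℝ} (hp : 0 < p) (hq : 0 < q)
    (hpq : 1 / p + 1 / q ≤ 1) {n : ℕ} (hn : 0 < n) :
    bilinNorm 𝕂 p q (dotProductBilin 𝕂 𝕂 : (Fin n → 𝕂) →ₗ[𝕂] (Fin n → 𝕂) →ₗ[𝕂] 𝕂)
      ≤ (n : ℝ) ^ (1 - 1 / p - 1 / q) := by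
  have : Nonempty (Fin n) := ⟨⟨0, hn⟩⟩
  refine Real.sSup_le ?_ (by positivity)
  rintro t ⟨x, y, hx, hy, rfl⟩
  calc ‖dotProductBilin 𝕂 𝕂 x y‖ ≤ ∑ i, ‖x i‖ * ‖y i‖ := by
        simpa [dotProduct] using norm_sum_le Finset.univ fun i => x i * y i
    _ ≤ (n : ℝ) ^ (1 - 1 / p - 1 / q) := by
        simpa using sum_mul_le_card_rpow hp hq hpq (fun i => norm_nonneg (x i))
          (fun i => norm_nonneg (y i)) (sum_rpow_le_one_of_lpNorm_le_one hp hx)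
          (sum_rpow_le_one_of_lpNorm_le_one hq hy)

theorem sum_norm_dotProductBilin_single_rpow (𝕂 : Type*) [RCLike 𝕂] (n : ℕ) {r : ℝ}
    (hr : r ≠ 0) :
    ∑ j : Fin n, ∑ k : Fin n,
      ‖dotProductBilin 𝕂 𝕂 (Pi.single j (1 : 𝕂)) (Pi.single k (1 : 𝕂))‖ ^ r = n := by
  have hjk (j k : Fin n) :
      ‖dotProductBilin 𝕂 𝕂 (Pi.single j (1 : 𝕂)) (Pi.single k (1 : 𝕂))‖ ^ r
        = if j = k then 1 else 0 := by
    by_cases hj : j = k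
    · simp [hj]
    · simp [hj, Real.zero_rpow hr]
  simp only [hjk, Finset.sum_ite_eq, Finset.mem_univ, if_true, Finset.sum_const,
    Finset.card_univ, Fintype.card_fin, nsmul_eq_mul, mul_one]

theorem le_of_forall_natCast_rpow_le {a b C : ℝ}
    (h : ∀ n : ℕ, 0 < n → (n : ℝ) ^ a ≤ C * (n : ℝ) ^ b) : a ≤ b := by
  by_contra! hab
  have ht := (tendsto_rpow_atTop (sub_pos.2 hab)).comp tendsto_natCast_atTop_atTop
  obtain ⟨n, hn, hn0⟩ :=
    ((ht.eventually_gt_atTop C).and (Filter.eventually_gt_atTop (0 : ℕ))).exists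
  have hpos : (0 : ℝ) < n := Nat.cast_pos.2 hn0
  rw [Function.comp_apply, Real.rpow_sub hpos, lt_div_iff₀ (by positivity)] at hn
  exact absurd (h n hn0) hn.not_ge

theorem bilinear_HL_exponent_optimal
    (𝕂 : Type*) [RCLike 𝕂] (p q : ℝ) (hp : 2 ≤ p) (hq : 2 ≤ q)
    (hpq1 : 1 / 2 < 1 / p + 1 / q) (hpq2 : 1 / p + 1 / q < 1)
    (r C : ℝ) (hr : 0 < r) (hC : 0 < C)
    (h : ∀ n : ℕ, 0 < n → ∀ A : (Fin n → 𝕂) →ₗ[𝕂] (Fin n → 𝕂) →ₗ[𝕂] 𝕂,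
      (∑ j : Fin n, ∑ k : Fin n,
          ‖A (Pi.single j (1 : 𝕂)) (Pi.single k (1 : 𝕂))‖ ^ r) ^ (1 / r)
        ≤ C * bilinNorm 𝕂 p q A) :
    p * q / (p * q - p - q) ≤ r := by
  have hp0 : 0 < p := by linarith
  have hq0 : 0 < q := by linarith
  have hrs : 1 / r ≤ 1 - 1 / p - 1 / q := by
    refine le_of_forall_natCast_rpow_le (C := C) fun n hn => ?_
    have hA := h n hn (dotProductBilin 𝕂 𝕂)
    rw [sum_norm_dotProductBilin_single_rpow 𝕂 n hr.ne'] at hA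
    exact hA.trans
      (mul_le_mul_of_nonneg_left (bilinNorm_dotProductBilin_le 𝕂 hp0 hq0 hpq2.le hn) hC.le)
  have hexp : p * q / (p * q - p - q) = 1 / (1 - 1 / p - 1 / q) := by
    rw [show 1 - 1 / p - 1 / q = (p * q - p - q) / (p * q) by field_simp; ring, one_div_div]
  rw [hexp]
  exact (one_div_le hr (by linarith)).1 hrs
end
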